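/- Invariance of the numbers of colored odd and colored even cutting spanning subgraphs under single-edge partial duality: for any ribbon graph with flags G and any edge e ∈ E(G), 2^{v(G)} · |OddF(G)| = 2^{v(G^{{e}})} · |OddF(G^{{e}})| and 2^{v(G)} · |EvF(G)| = 2^{v(G^{{e}})} · |EvF(G^{{e}})|. -/

import Mathlib

set_option linter.unusedSectionVars false

open Finset

namespace RibbonPaper

variable {X : Type} [Fintype X] [DecidableEq X]

/-- Raw combinatorial data of a ribbon graph with flags: three permutations of
the finite set of crosses. -/
structure RawRibbon (X : Type) [Fintype X] [DecidableEq X] where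
  s0 : Equiv.Perm X
  th : Equiv.Perm X
  s1 : Equiv.Perm X

namespace RawRibbon

/-- The axioms of a combinatorial map with flags (ribbon graph with flags). -/
def IsRibbon (G : RawRibbon X) : Prop :=
  G.th ^ 2 = 1 ∧ G.s1 ^ 2 = 1 ∧ G.th * G.s1 = G.s1 * G.th ∧
    (∀ x, G.th x ≠ x) ∧ (∀ x, G.th x ≠ G.s1 x) ∧
    G.s0 * G.th = G.th * G.s0⁻¹ ∧
    ∀ (x : X) (n : ℤ), (G.s0 ^ n) x ≠ G.th x

/-- A ribbon graph without flags: `σ₁` is fixed-point free. -/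
def NoFlags (G : RawRibbon X) : Prop := ∀ x, G.s1 x ≠ x

/-- The edges: 4-element orbits `{x, θx, σ₁x, σ₁θx}` of crosses not fixed by `σ₁`. -/
def edges (G : RawRibbon X) : Finset (Finset X) :=
  (Finset.univ.filter fun x => G.s1 x ≠ x).image
    fun x => ({x, G.th x, G.s1 x, G.s1 (G.th x)} : Finset X)

/-- The flags: pairs `{x, θ x}` of crosses fixed by `σ₁`. -/
def flags (G : RawRibbon X) : Finset (Finset X) :=
  (Finset.univ.filter fun x => G.s1 x = x).image fun x => ({x, G.th x} : Finset X)

/-- The half-ribbons: all pairs `{x, θ x}`. -/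
def halfRibbons (G : RawRibbon X) : Finset (Finset X) :=
  Finset.univ.image fun x => ({x, G.th x} : Finset X)

/-- Orbit of a point under a permutation, as a finset. -/
def permOrbit (f : Equiv.Perm X) (x : X) : Finset X :=
  (Finset.range (Fintype.card X)).image fun n => (f ^ n) x

/-- The vertex containing the cross `x`: the union of the `σ₀`-cycles of `x` and `θ x`. -/
def vertexOf (G : RawRibbon X) (x : X) : Finset X :=
  permOrbit G.s0 x ∪ permOrbit G.s0 (G.th x)

/-- The vertices of the ribbon graph, as finsets of crosses. -/
def vertices (G : RawRibbon X) : Finset (Finset X) :=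
  Finset.univ.image G.vertexOf

/-- `degB G B v` : the number of half-edges incident to `v` that belong to edges of `B`,
plus the number of flags incident to `v`. -/
def degB (G : RawRibbon X) (B : Finset (Finset X)) (v : Finset X) : ℕ :=
  (G.halfRibbons.filter fun h => h ⊆ v ∧ (h ∈ G.flags ∨ ∃ e ∈ B, h ⊆ e)).card

/-- `φ_S` : the permutation agreeing with `f` on `S` and the identity off `S`
(defined whenever `S` is `f`-invariant, and the identity otherwise). -/
def permRestrict (f : Equiv.Perm X) (S : Finset X) : Equiv.Perm X :=
  if h : ∀ x : X, x ∈ S ↔ f x ∈ S then Equiv.Perm.ofSubtype (f.subtypePerm (p := fun x => x ∈ S) fun x => (h x).symm) else 1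

/-- The set of crosses of a set of edges. -/
def crossSet (E' : Finset (Finset X)) : Finset X := E'.biUnion id

/-- Chmutov's partial dual `G^{E'}`. -/
def partialDual (G : RawRibbon X) (E' : Finset (Finset X)) : RawRibbon X where
  s0 := G.s0 * permRestrict G.th (crossSet E') * permRestrict G.s1 (crossSet E')
  th := permRestrict G.s1 (crossSet E') * permRestrict G.th (crossSet E')ᶜ
  s1 := permRestrict G.s1 (crossSet E')ᶜ * permRestrict G.th (crossSet E')

/-- The topological polynomial `Q` of a ribbon graph with flags. -/
def Qpoly {R : Type} [CommRing R] (G : RawRibbon X) (x y z w : Finset X → R) (r : ℕ → R) : R :=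
  ∑ A ∈ G.edges.powerset, ∑ B ∈ (G.partialDual A).edges.powerset,
    (∏ e ∈ (G.edges \ A) ∩ ((G.partialDual A).edges \ B), x e) *
      (∏ e ∈ A ∩ ((G.partialDual A).edges \ B), y e) *
      (∏ e ∈ A ∩ B, z e) *
      (∏ e ∈ (G.edges \ A) ∩ B, w e) *
      ∏ v ∈ (G.partialDual A).vertices, r (degB (G.partialDual A) B v)

/-- The first hyperbolic polynomial `HU` as an evaluation of `Q`. -/
noncomputable def HU (G : RawRibbon X) (Ω t : Finset X → ℝ) : ℝ :=
  Qpoly G t Ω (fun e => Ω e * t e ^ 2) (fun e => t e * Ω e ^ 2)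
    fun n => if Even n then 0 else 2

end RawRibbon

end RibbonPaper

theorem test : True := trivial
namespace RibbonPaper

namespace RawRibbon

variable {X : Type} [Fintype X] [DecidableEq X]

lemma firstRet_exists (f : Equiv.Perm X) (S : Finset X) {x : X} (hx : x ∈ S) :
    ∃ k : ℕ, 0 < k ∧ (f ^ k) x ∈ S :=
  ⟨orderOf f, orderOf_pos f, by rw [pow_orderOf_eq_one]; simpa using hx⟩

open scoped Classical in
/-- The first-return map of a permutation on a subset. -/
noncomputable def firstRet (f : Equiv.Perm X) (S : Finset X) (x : X) : X :=
  if h : ∃ k : ℕ, 0 < k ∧ (f ^ k) x ∈ S then (f ^ Nat.find h) x else x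

lemma firstRet_mem (f : Equiv.Perm X) (S : Finset X) {x : X} (hx : x ∈ S) :
    firstRet f S x ∈ S := by
  rw [firstRet, dif_pos (firstRet_exists f S hx)]
  exact (Nat.find_spec (firstRet_exists f S hx)).2

lemma firstRet_inj_aux (f : Equiv.Perm X) (S : Finset X) {x y : X}
    (hx : x ∈ S) (hy : y ∈ S)
    (hle : Nat.find (firstRet_exists f S hx) ≤ Nat.find (firstRet_exists f S hy))
    (h : firstRet f S x = firstRet f S y) : x = y := by
  have hex := firstRet_exists f S hx
  have hey := firstRet_exists f S hy
  rw [firstRet, dif_pos hex, firstRet, dif_pos hey] at h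
  have hxy : x = (f ^ (Nat.find hey - Nat.find hex)) y := by
    apply Equiv.injective (f ^ Nat.find hex)
    rw [← Equiv.Perm.mul_apply, ← pow_add, Nat.add_sub_cancel' hle]
    exact h
  by_cases h0 : Nat.find hey - Nat.find hex = 0
  · rw [h0, pow_zero] at hxy
    simpa using hxy
  · exfalso
    have hlt : Nat.find hey - Nat.find hex < Nat.find hey :=
      Nat.sub_lt (Nat.find_spec hey).1 (Nat.find_spec hex).1
    apply Nat.find_min hey hlt
    refine ⟨Nat.pos_of_ne_zero h0, ?_⟩
    rw [hxy] at hx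
    exact hx

lemma firstRet_inj (f : Equiv.Perm X) (S : Finset X) {x y : X}
    (hx : x ∈ S) (hy : y ∈ S) (h : firstRet f S x = firstRet f S y) : x = y := by
  rcases le_total (Nat.find (firstRet_exists f S hx)) (Nat.find (firstRet_exists f S hy)) with
    hle | hle
  · exact firstRet_inj_aux f S hx hy hle h
  · exact (firstRet_inj_aux f S hy hx hle h.symm).symm

/-- The permutation induced on a subset `S` by a permutation of `X`
(the first-return map). -/
noncomputable def inducedPerm (f : Equiv.Perm X) (S : Finset X) : Equiv.Perm {x : X // x ∈ S} :=
  Equiv.ofBijective (fun a => ⟨firstRet f S a.1, firstRet_mem f S a.2⟩)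
    (Finite.injective_iff_bijective.mp fun a b hab =>
      Subtype.ext (firstRet_inj f S a.2 b.2 (congrArg Subtype.val hab)))

/-- The ribbon graph obtained by restricting to a subset `S` of the crosses
(deleting all crosses outside `S`). -/
noncomputable def restrict (G : RawRibbon X) (S : Finset X) : RawRibbon {x : X // x ∈ S} :=
  ⟨inducedPerm G.s0 S, inducedPerm G.th S, inducedPerm G.s1 S⟩

/-- Deletion of an edge `e` (given by its finset of crosses). -/
noncomputable def delete (G : RawRibbon X) (e : Finset X) : RawRibbon {x : X // x ∈ eᶜ} :=
  G.restrict eᶜ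

/-- The cut of an edge `e`: `σ₁` is replaced by `(σ₁)_{X∖e}`, so the two
half-edges of `e` become flags. -/
def cut (G : RawRibbon X) (e : Finset X) : RawRibbon X :=
  ⟨G.s0, G.th, permRestrict G.s1 eᶜ⟩

/-- Connectivity: the crosses form a single orbit under the group generated by the
three permutations. -/
def Connected (G : RawRibbon X) : Prop :=
  ∀ x y : X, ∃ g ∈ Subgroup.closure ({G.s0, G.th, G.s1} : Set (Equiv.Perm X)), g x = y

/-- Two vertices are linked by an edge of `A` if `e ∈ A` has a half-edge incident to each. -/
def linked (G : RawRibbon X) (A : Finset (Finset X)) (u v : Finset X) : Prop :=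
  ∃ e ∈ A, (∃ h ∈ G.halfRibbons, h ⊆ e ∧ h ⊆ u) ∧ ∃ h ∈ G.halfRibbons, h ⊆ e ∧ h ⊆ v

/-- Connectivity of two vertices in the spanning subgraph `(V(G), A)`. -/
def vconn (G : RawRibbon X) (A : Finset (Finset X)) : Finset X → Finset X → Prop :=
  Relation.ReflTransGen (G.linked A)

/-- The spanning subgraph `(V(G), A)` is connected. -/
def SpanningConn (G : RawRibbon X) (A : Finset (Finset X)) : Prop :=
  ∀ u ∈ G.vertices, ∀ v ∈ G.vertices, G.vconn A u v

/-- The number of faces (boundary components) of a ribbon graph: the number of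
vertices of its natural dual. -/
def nFaces (G : RawRibbon X) : ℕ := (G.partialDual G.edges).vertices.card

/-- The number of boundary components of the spanning subgraph of `G` with surviving
crosses `S`, counting also the vertices of `G` that have become isolated. -/
noncomputable def nBoundary (G : RawRibbon X) (S : Finset X) : ℕ :=
  (G.restrict S).nFaces + (G.vertices.filter fun v => Disjoint v S).card

/-- A spanning quasi-tree: the spanning subgraph `(V(G), A)` is connected and has
exactly one face. -/
def IsQuasiTree (G : RawRibbon X) (A : Finset (Finset X)) : Prop :=
  G.SpanningConn A ∧ G.nBoundary (crossSet A) = 1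

/-- A spanning tree: the spanning subgraph `(V(G), A)` is connected and
`|A| = v(G) - 1`. -/
def IsSpanningTree (G : RawRibbon X) (A : Finset (Finset X)) : Prop :=
  G.SpanningConn A ∧ A.card + 1 = G.vertices.card

open scoped Classical in
/-- The first Symanzik polynomial of the noncommutative heat-kernel theory. -/
noncomputable def Upoly (G : RawRibbon X) (α : Finset X → ℝ) (θ : ℝ) : ℝ :=
  ∑ A ∈ G.edges.powerset.filter (fun A => G.IsQuasiTree A),
    (θ / 2) ^ (A.card + 1 - G.vertices.card) * ∏ e ∈ G.edges \ A, α e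

end RawRibbon

end RibbonPaper
namespace RibbonPaper

namespace RawRibbon

variable {X : Type} [Fintype X] [DecidableEq X]

/-- Even spanning subgraphs of `G`. -/
def evenSubs (G : RawRibbon X) : Finset (Finset (Finset X)) :=
  G.edges.powerset.filter fun B => ∀ v ∈ G.vertices, Even (G.degB B v)

/-- Odd spanning subgraphs of `G`. -/
def oddSubs (G : RawRibbon X) : Finset (Finset (Finset X)) :=
  G.edges.powerset.filter fun B => ∀ v ∈ G.vertices, Odd (G.degB B v)

/-- Odd cutting spanning subgraphs of `G`: subsets of half-ribbons such that every
vertex is incident to an odd number of them. -/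
def oddCutting (G : RawRibbon X) : Finset (Finset (Finset X)) :=
  G.halfRibbons.powerset.filter fun H =>
    ∀ v ∈ G.vertices, Odd ((H.filter fun h => h ⊆ v).card)

/-- Even cutting spanning subgraphs of `G`. -/
def evenCutting (G : RawRibbon X) : Finset (Finset (Finset X)) :=
  G.halfRibbons.powerset.filter fun H =>
    ∀ v ∈ G.vertices, Even ((H.filter fun h => h ⊆ v).card)

/-- The flag-set of a cutting spanning subgraph `H`: the flags of `G` contained in `H`
together with the edges exactly one of whose two half-edges lies in `H`. -/
def flagSetOf (G : RawRibbon X) (H : Finset (Finset X)) : Finset (Finset X) :=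
  (G.flags ∩ H) ∪ (G.edges.filter fun e => (H.filter fun h => h ⊆ e).card = 1)

/-- Orientability of a ribbon graph with flags. -/
def Orientable (G : RawRibbon X) : Prop :=
  ∃ Xp : Finset X,
    Xp.image G.s0 = Xp ∧ Disjoint Xp (Xp.image G.th) ∧
      Xp ∪ Xp.image G.th = Finset.univ ∧
      ∀ x : X, G.s1 x ≠ x → (x ∈ Xp ↔ G.s1 x ∉ Xp)

/-- The edge variable of the edge of `G` containing the half-ribbon `h`
(as a product over the containing edges; a flag contributes `1`). -/
def halfWeight {R : Type} [CommRing R] (G : RawRibbon X) (t : Finset X → R)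
    (h : Finset X) : R :=
  ∏ e ∈ G.edges.filter (fun e => h ⊆ e), t e

/-- The vertex containing a given half-ribbon. -/
def vertexOfHalf (G : RawRibbon X) (h : Finset X) : Finset X :=
  (G.vertices.filter fun v => h ⊆ v).sup id

/-- The spin product `σ_u σ_{u'}` over the endpoints of an edge `e`, for the spin
configuration assigning `+1` to vertices in `T` and `-1` to the others. -/
noncomputable def spinProd (G : RawRibbon X) (T : Finset (Finset X)) (e : Finset X) : ℝ :=
  ∏ h ∈ G.halfRibbons.filter (fun h => h ⊆ e),
    (if G.vertexOfHalf h ∈ T then (1 : ℝ) else -1)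

/-- An isolated vertex of even degree: incident to no half-edge and to an even
number of flags. -/
def IsIsolatedEvenVertex (G : RawRibbon X) (v : Finset X) : Prop :=
  v ∈ G.vertices ∧ (∀ h ∈ G.halfRibbons, h ⊆ v → h ∈ G.flags) ∧
    Even ((G.flags.filter fun h => h ⊆ v).card)

open scoped Classical in
/-- The number of endpoints of edges of `B` lying in the `A`-connected component of the
vertex `v`, plus the number of flags attached to vertices of that component. -/
noncomputable def compDeg (G : RawRibbon X) (A B : Finset (Finset X)) (v : Finset X) : ℕ :=
  (G.halfRibbons.filter fun h =>
      (h ∈ G.flags ∨ ∃ e ∈ B, h ⊆ e) ∧ ∃ u ∈ G.vertices, G.vconn A v u ∧ h ⊆ u).card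

/-- `(B, V(G/A))` is odd: every connected component of the spanning subgraph
`(V(G), A)` sees an odd number of endpoints of edges of `B` plus flags. -/
def CompOdd (G : RawRibbon X) (A B : Finset (Finset X)) : Prop :=
  ∀ v ∈ G.vertices, Odd (compDeg G A B v)

open scoped Classical in
/-- The connected component of the vertex `v` in the spanning subgraph `(V(G), A)`. -/
noncomputable def compVerts (G : RawRibbon X) (A : Finset (Finset X)) (v : Finset X) :
    Finset (Finset X) :=
  G.vertices.filter fun u => G.vconn A v u

/-- The connected components of the spanning subgraph `(V(G), A)`. -/
noncomputable def components (G : RawRibbon X) (A : Finset (Finset X)) :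
    Finset (Finset (Finset X)) :=
  G.vertices.image fun v => compVerts G A v

/-- The edges of `A` incident to a set of vertices `c`. -/
def compEdges (G : RawRibbon X) (A : Finset (Finset X)) (c : Finset (Finset X)) :
    Finset (Finset X) :=
  A.filter fun e => ∃ h ∈ G.halfRibbons, h ⊆ e ∧ ∃ u ∈ c, h ⊆ u

open scoped Classical in
/-- The cycle edges of a (unicyclic) component `c`: those edges whose removal keeps
the component connected. -/
noncomputable def cycleEdges (G : RawRibbon X) (A : Finset (Finset X))
    (c : Finset (Finset X)) : Finset (Finset X) :=
  (compEdges G A c).filter fun e => ∀ u ∈ c, ∀ u' ∈ c, G.vconn (A.erase e) u u'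

/-- The weight of a connected component in the commutative Mehler-kernel limit. -/
noncomputable def compWeight (G : RawRibbon X) (A : Finset (Finset X)) (Ω t : Finset X → ℝ)
    (c : Finset (Finset X)) : ℝ :=
  if (compEdges G A c).card + 1 = c.card then
    (2 : ℝ) ^ (1 - ((compEdges G A c).card : ℤ)) *
      ∑ e ∈ compEdges G A c,
        Ω e ^ 2 * t e * ∏ e' ∈ (compEdges G A c).erase e, Ω e' * (1 + t e' ^ 2)
  else
    (2 : ℝ) ^ (2 - ((compEdges G A c).card : ℤ)) *
      ∑ C' ∈ (cycleEdges G A c).powerset.filter (fun C' => Odd C'.card),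
        (∏ e ∈ C', Ω e * t e ^ 2) *
          ∏ e' ∈ compEdges G A c \ cycleEdges G A c, Ω e' * (1 + t e' ^ 2)

/-- The graph `Ĝ_{i₀}` : the half-edge `i₀` (with crosses `x₀, θ x₀`) is detached from
its vertex, replaced there by a flag (crosses `inr 0, inr 1`), and attached to a new
bivalent vertex carrying one more flag (crosses `inr 2, inr 3`). -/
def hatGraph (G : RawRibbon X) (x₀ : X) : RawRibbon (X ⊕ Fin 4) where
  s0 :=
    (Equiv.swap (Sum.inl x₀) (Sum.inr 0) * Equiv.swap (Sum.inl (G.th x₀)) (Sum.inr 1)) *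
        Equiv.sumCongr G.s0 (Equiv.refl (Fin 4)) *
        (Equiv.swap (Sum.inl x₀) (Sum.inr 0) * Equiv.swap (Sum.inl (G.th x₀)) (Sum.inr 1))⁻¹ *
      Equiv.swap (Sum.inl x₀) (Sum.inr 2) * Equiv.swap (Sum.inl (G.th x₀)) (Sum.inr 3)
  th := Equiv.sumCongr G.th (Equiv.swap 0 1 * Equiv.swap 2 3)
  s1 := Equiv.sumCongr G.s1 (Equiv.refl (Fin 4))

end RawRibbon

end RibbonPaper
namespace RibbonPaper
namespace RawRibbon

variable {X : Type} [Fintype X] [DecidableEq X]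

lemma s8_fiber (half V : Finset (Finset X))
    (hr : ∀ v ∈ V, ∃ h ∈ half, ∀ w ∈ V, h ⊆ w ↔ w = v) (T : Finset (Finset X)) (hT : T ⊆ V) :
    2 ^ V.card * (half.powerset.filter fun H =>
      V.filter (fun v => Odd ((H.filter fun h => h ⊆ v).card)) = T).card = 2 ^ half.card := by
  classical
  choose! r hr1 hr2 using hr
  have key : ∀ U ⊆ V, ∀ H : Finset (Finset X), ∀ w ∈ V,
      (Odd (((symmDiff H (U.image r)).filter fun h => h ⊆ w).card) ↔
        Xor (Odd ((H.filter fun h => h ⊆ w).card)) (w ∈ U)) := by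
    intro U hU H w hw
    have h1 : (U.image r).filter (fun h => h ⊆ w) = if w ∈ U then {r w} else ∅ := by
      ext h
      simp only [mem_filter, mem_image]
      constructor
      · rintro ⟨⟨u, hu, rfl⟩, h2⟩
        have := (hr2 u (hU hu) w hw).1 h2
        subst this
        simp [hu]
      · split_ifs with h3
        · simp only [mem_singleton]
          rintro rfl
          exact ⟨⟨w, h3, rfl⟩, (hr2 w hw w hw).2 rfl⟩
        · simp
    have h2 : (symmDiff H (U.image r)).filter (fun h => h ⊆ w) =
        symmDiff (H.filter fun h => h ⊆ w) (if w ∈ U then {r w} else ∅) := by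
      rw [← h1]
      ext h
      simp only [mem_filter, mem_symmDiff]
      tauto
    rw [h2]
    split_ifs with h3
    · by_cases h4 : r w ∈ H.filter fun h => h ⊆ w
      · have : symmDiff (H.filter fun h => h ⊆ w) {r w} = (H.filter fun h => h ⊆ w).erase (r w) := by
          ext h; simp only [mem_symmDiff, mem_singleton, mem_erase]
          by_cases h5 : h = r w
          · subst h5; tauto
          · tauto
        rw [this]
        have := Finset.card_erase_add_one h4
        rw [← this]
        simp [h3, Nat.odd_add_one, Xor]
      · have : symmDiff (H.filter fun h => h ⊆ w) {r w} = insert (r w) (H.filter fun h => h ⊆ w) := by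
          ext h; simp only [mem_symmDiff, mem_singleton, mem_insert]
          by_cases h5 : h = r w
          · subst h5; tauto
          · tauto
        rw [this, Finset.card_insert_of_notMem h4]
        simp [h3, Nat.odd_add_one, Xor]
    · have : symmDiff (H.filter fun h => h ⊆ w) ∅ = (H.filter fun h => h ⊆ w) := by
        ext h; simp [mem_symmDiff]
      rw [this]
      simp [h3, Xor]
  have hle : ∀ U ⊆ V, ∀ W ⊆ V, (half.powerset.filter fun H =>
      V.filter (fun v => Odd ((H.filter fun h => h ⊆ v).card)) = U).card ≤
      (half.powerset.filter fun H =>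
      V.filter (fun v => Odd ((H.filter fun h => h ⊆ v).card)) = W).card := by
    intro U hU W hW
    have hUW : symmDiff U W ⊆ V := by
      intro z hz
      rw [mem_symmDiff] at hz
      rcases hz with h | h
      · exact hU h.1
      · exact hW h.1
    apply Finset.card_le_card_of_injOn (fun H => symmDiff H ((symmDiff U W).image r))
    · intro H hH
      simp only [coe_filter, Set.mem_ofPred_eq, mem_powerset] at hH ⊢
      refine ⟨?_, ?_⟩
      · intro z hz
        rw [mem_symmDiff] at hz
        rcases hz with h | h
        · exact hH.1 h.1
        · obtain ⟨u, hu, rfl⟩ := mem_image.1 h.1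
          exact hr1 u (hUW hu)
      · ext w
        have h1 := Finset.ext_iff.1 hH.2 w
        simp only [mem_filter] at h1 ⊢
        by_cases hw : w ∈ V
        · rw [key _ hUW H w hw, mem_symmDiff]
          simp only [Xor]
          tauto
        · have := @hW w
          tauto
    · intro H _ H' _ h
      exact symmDiff_left_injective _ h
  have hsum := Finset.card_eq_sum_card_fiberwise (s := half.powerset) (t := V.powerset)
    (f := fun H => V.filter (fun v => Odd ((H.filter fun h => h ⊆ v).card)))
    (by intro H _; exact mem_powerset.2 (filter_subset _ _))
  rw [card_powerset] at hsum
  rw [hsum, Finset.sum_congr rfl (fun U hU => le_antisymm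
    (hle U (mem_powerset.1 hU) T hT) (hle T hT U (mem_powerset.1 hU)))]
  simp

lemma s8_mem_permOrbit (f : Equiv.Perm X) (x y : X) : y ∈ permOrbit f x ↔ f.SameCycle x y := by
  simp only [permOrbit, mem_image, mem_range]
  constructor
  · rintro ⟨n, _, rfl⟩
    exact ⟨n, by simp⟩
  · intro h
    by_cases hx : f x = x
    · have : y = x := (h.eq_of_left hx).symm
      subst this
      exact ⟨0, Fintype.card_pos_iff.2 ⟨y⟩, by simp⟩
    · obtain ⟨n, hn, h2⟩ := h.exists_pow_eq_of_mem_support (Equiv.Perm.mem_support.2 hx)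
      exact ⟨n, lt_of_lt_of_le hn (Finset.card_le_univ _), h2⟩

structure S8Good (G : RawRibbon X) : Prop where
  tt : ∀ x, G.th (G.th x) = x
  ne : ∀ x, G.th x ≠ x
  st : ∀ x, G.s0 (G.th (G.s0 x)) = G.th x

variable {G : RawRibbon X}

lemma S8Good.pow (hG : S8Good G) (n : ℤ) (x : X) : G.th ((G.s0 ^ n) x) = (G.s0 ^ (-n)) (G.th x) := by
  have h : G.th * G.s0 * G.th⁻¹ = G.s0⁻¹ := by
    ext x
    have h1 : G.th⁻¹ x = G.th x := by rw [Equiv.Perm.inv_eq_iff_eq, hG.tt]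
    rw [Equiv.Perm.eq_inv_iff_eq]
    simp only [Equiv.Perm.mul_apply, h1, hG.st, hG.tt]
  have h2 : G.th * G.s0 ^ n * G.th⁻¹ = G.s0 ^ (-n) := by
    rw [← conj_zpow, h, inv_zpow, zpow_neg]
  rw [← h2]
  simp

lemma S8Good.same (hG : S8Good G) {x y : X} (h : G.s0.SameCycle x y) :
    G.s0.SameCycle (G.th x) (G.th y) := by
  obtain ⟨n, rfl⟩ := h
  exact ⟨-n, (hG.pow n x).symm⟩

lemma S8Good.mem (hG : S8Good G) (x y : X) :
    y ∈ G.vertexOf x ↔ G.vertexOf y = G.vertexOf x := by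
  have hm : ∀ x y, y ∈ G.vertexOf x ↔ (G.s0.SameCycle x y ∨ G.s0.SameCycle (G.th x) y) := by
    intro x y
    simp [vertexOf, s8_mem_permOrbit]
  have hsymm : ∀ x y, y ∈ G.vertexOf x → x ∈ G.vertexOf y := by
    intro x y
    rw [hm, hm]
    rintro (h | h)
    · exact Or.inl h.symm
    · right
      have := hG.same h
      rw [hG.tt] at this
      exact this.symm
  have htrans : ∀ x y z, y ∈ G.vertexOf x → z ∈ G.vertexOf y → z ∈ G.vertexOf x := by
    intro x y z
    rw [hm, hm, hm]
    rintro (h | h) (h' | h')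
    · exact Or.inl (h.trans h')
    · exact Or.inr ((hG.same h).trans h')
    · exact Or.inr (h.trans h')
    · have := hG.same h
      rw [hG.tt] at this
      exact Or.inl (this.trans h')
  constructor
  · intro h
    ext z
    exact ⟨htrans x y z h, htrans y x z (hsymm x y h)⟩
  · intro h
    rw [← h, hm]
    exact Or.inl (Equiv.Perm.SameCycle.refl _ _)

lemma S8Good.rep (hG : S8Good G) : ∀ v ∈ G.vertices, ∃ h ∈ G.halfRibbons,
    ∀ w ∈ G.vertices, h ⊆ w ↔ w = v := by
  intro v hv
  obtain ⟨x, -, rfl⟩ := mem_image.1 hv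
  refine ⟨{x, G.th x}, mem_image.2 ⟨x, mem_univ _, rfl⟩, ?_⟩
  intro w hw
  obtain ⟨y, -, rfl⟩ := mem_image.1 hw
  rw [insert_subset_iff, singleton_subset_iff, hG.mem, hG.mem]
  have : G.vertexOf (G.th x) = G.vertexOf x := by
    rw [← hG.mem, vertexOf, mem_union, s8_mem_permOrbit, s8_mem_permOrbit]
    exact Or.inr (Equiv.Perm.SameCycle.refl _ _)
  rw [this]
  exact ⟨fun h => h.1.symm, fun h => ⟨h.symm, h.symm⟩⟩

lemma S8Good.half (hG : S8Good G) : G.halfRibbons.card * 2 = Fintype.card X := by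
  rw [← Finset.card_univ, Finset.card_eq_sum_card_fiberwise (s := univ) (t := G.halfRibbons)
    (f := fun x => ({x, G.th x} : Finset X)) (fun x _ => by simp [halfRibbons])]
  rw [Finset.sum_congr rfl (g := fun _ => 2)]
  · simp
  · intro h hh
    obtain ⟨x, -, rfl⟩ := mem_image.1 hh
    have : (univ.filter fun y => ({y, G.th y} : Finset X) = {x, G.th x}) = {x, G.th x} := by
      ext y
      simp only [mem_filter, mem_univ, true_and]
      constructor
      · intro h
        rw [← h]; simp
      · intro h
        simp only [mem_insert, mem_singleton] at h
        rcases h with rfl | rfl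
        · rfl
        · rw [hG.tt, pair_comm]
    rw [this, card_pair (hG.ne x).symm]

lemma S8Good.odd (hG : S8Good G) :
    2 ^ G.vertices.card * (oddCutting G).card = 2 ^ (Fintype.card X / 2) := by
  rw [← hG.half, Nat.mul_div_cancel _ two_pos, ← s8_fiber _ _ hG.rep G.vertices subset_rfl]
  congr 2
  ext H
  simp [oddCutting, Finset.filter_eq_self]

lemma S8Good.even (hG : S8Good G) :
    2 ^ G.vertices.card * (evenCutting G).card = 2 ^ (Fintype.card X / 2) := by
  rw [← hG.half, Nat.mul_div_cancel _ two_pos, ← s8_fiber _ _ hG.rep ∅ (empty_subset _)]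
  congr 2
  ext H
  simp [evenCutting, Finset.filter_eq_empty_iff]

lemma s8_permRestrict (f : Equiv.Perm X) (S : Finset X) (h : ∀ x : X, x ∈ S ↔ f x ∈ S) (y : X) :
    permRestrict f S y = if y ∈ S then f y else y := by
  rw [permRestrict, dif_pos h]
  split_ifs with hy
  · rw [Equiv.Perm.ofSubtype_apply_of_mem _ hy]; rfl
  · rw [Equiv.Perm.ofSubtype_apply_of_not_mem _ hy]

lemma s8_good (hG : G.IsRibbon) : S8Good G := by
  obtain ⟨h1, h2, h3, h4, h5, h6, h7⟩ := hG
  have tt : ∀ x, G.th (G.th x) = x := fun x => by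
    have := Equiv.congr_fun h1 x
    simpa [pow_two] using this
  refine ⟨tt, h4, fun x => ?_⟩
  have := Equiv.congr_fun h6 (G.s0 x)
  simpa using this

lemma s8_dual (hG : G.IsRibbon) (e : Finset X) (he : e ∈ G.edges) :
    S8Good (G.partialDual {e}) := by
  have hg := s8_good hG
  obtain ⟨h1, h2, h3, h4, h5, h6, h7⟩ := hG
  have ss : ∀ x, G.s1 (G.s1 x) = x := fun x => by
    have := Equiv.congr_fun h2 x
    simpa [pow_two] using this
  have ts : ∀ x, G.th (G.s1 x) = G.s1 (G.th x) := fun x => Equiv.congr_fun h3 x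
  have hc : crossSet {e} = e := by simp [crossSet]
  obtain ⟨x, hx, rfl⟩ := mem_image.1 he
  simp only [mem_filter, mem_univ, true_and] at hx
  set S : Finset X := {x, G.th x, G.s1 x, G.s1 (G.th x)} with hS
  have hS1 : ∀ y ∈ S, G.th y ∈ S := by
    intro y hy
    simp only [hS, mem_insert, mem_singleton] at hy ⊢
    rcases hy with rfl | rfl | rfl | rfl <;> simp [hg.tt, ts]
  have hS2 : ∀ y ∈ S, G.s1 y ∈ S := by
    intro y hy
    simp only [hS, mem_insert, mem_singleton] at hy ⊢
    rcases hy with rfl | rfl | rfl | rfl <;> simp [ss]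
  have hne : ∀ y ∈ S, G.s1 y ≠ y := by
    intro y hy
    simp only [hS, mem_insert, mem_singleton] at hy
    rcases hy with rfl | rfl | rfl | rfl
    · exact hx
    · rw [← ts]; exact fun h => hx (G.th.injective h)
    · exact fun h => hx (G.s1.injective h)
    · rw [← ts, ← ts]; exact fun h => hx (G.s1.injective (G.th.injective h))
  have i1 : ∀ y, y ∈ S ↔ G.th y ∈ S := fun y => ⟨hS1 y, fun h => by simpa [hg.tt] using hS1 _ h⟩
  have i2 : ∀ y, y ∈ S ↔ G.s1 y ∈ S := fun y => ⟨hS2 y, fun h => by simpa [ss] using hS2 _ h⟩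
  have i1c : ∀ y, y ∈ Sᶜ ↔ G.th y ∈ Sᶜ := fun y => by rw [mem_compl, mem_compl, i1]
  have eth : ∀ y, (G.partialDual {S}).th y = if y ∈ S then G.s1 y else G.th y := by
    intro y
    simp only [partialDual, hc, Equiv.Perm.mul_apply, s8_permRestrict _ _ i1c,
      s8_permRestrict _ _ i2, mem_compl]
    by_cases hy : y ∈ S
    · simp [hy]
    · simp [hy, (i1 y).not.1 hy]
  have es0 : ∀ y, (G.partialDual {S}).s0 y = G.s0 (if y ∈ S then G.th (G.s1 y) else y) := by
    intro y
    simp only [partialDual, hc, Equiv.Perm.mul_apply, s8_permRestrict _ _ i1,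
      s8_permRestrict _ _ i2]
    by_cases hy : y ∈ S
    · simp [hy, (i2 y).1 hy]
    · simp [hy]
  refine ⟨fun y => ?_, fun y => ?_, fun y => ?_⟩
  · rw [eth, eth]
    by_cases hy : y ∈ S
    · simp [hy, (i2 y).1 hy, ss]
    · simp [hy, (i1 y).not.1 hy, hg.tt]
  · rw [eth]
    split_ifs with hy
    · exact hne y hy
    · exact h4 y
  · have ed : ∀ z, (G.partialDual {S}).s0 ((G.partialDual {S}).th z) = G.s0 (G.th z) := by
      intro z
      rw [es0, eth]
      by_cases hz : z ∈ S
      · simp [hz, (i2 z).1 hz, ss]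
      · simp [hz, (i1 z).not.1 hz]
    rw [ed, es0, hg.st, eth]
    split_ifs with hy
    · rw [hg.tt]
    · rfl

end RawRibbon
end RibbonPaper

open RibbonPaper RawRibbon in
/-- invariance of the numbers of colored odd and even cutting spanning
subgraphs under single-edge partial duality. -/
theorem statement_8 {X : Type} [Fintype X] [DecidableEq X]
    (G : RawRibbon X) (hG : G.IsRibbon) (e : Finset X) (he : e ∈ G.edges) :
    2 ^ G.vertices.card * (oddCutting G).card =
        2 ^ (G.partialDual {e}).vertices.card * (oddCutting (G.partialDual {e})).card ∧
      2 ^ G.vertices.card * (evenCutting G).card =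
        2 ^ (G.partialDual {e}).vertices.card * (evenCutting (G.partialDual {e})).card := by

  have h1 := s8_good hG
  have h2 := s8_dual hG e he
  exact ⟨h1.odd.trans h2.odd.symm, h1.even.trans h2.even.symm⟩
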